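/- Let S be a commutative ring, let f_1, …, f_{r+1} be a regular sequence in S, and let I = (f_1, …, f_{r+1}). For each m ≥ 1, let H be the m × (m+r) matrix whose entry in position (i, j) is f_{j-i+1} if 1 ≤ j-i+1 ≤ r+1 and 0 otherwise (so the i-th diagonal of H has all entries equal to f_i). Then I^m equals the ideal I_m(H) generated by the m × m minors of H. -/

import Mathlib

theorem aux_perm_eq_one {m : ℕ} (c : Fin m → ℤ) (hc : StrictMono c) (σ : Equiv.Perm (Fin m))
    (h : Monovary c (fun i => ((σ i : ℕ) : ℤ))) : σ = 1 := by
  have hmono : StrictMono σ.symm := by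
    have : Monotone σ.symm := by
      intro x y hxy
      rcases hxy.eq_or_lt with rfl | hlt
      · exact le_rfl
      · have h1 : c (σ.symm x) ≤ c (σ.symm y) := by
          apply h
          simpa using hlt
        exact hc.le_iff_le.mp h1
    exact this.strictMono_of_injective σ.symm.injective
  have h2 : ∀ x, σ.symm x = x := by
    intro x
    have := Subsingleton.elim (hmono.orderIsoOfSurjective _ σ.symm.surjective) (OrderIso.refl _)
    exact congrArg (fun e : Fin m ≃o Fin m => e x) this
  ext x
  have := h2 (σ x)
  simp at this
  simp [← this]

theorem aux_sq_lt {m : ℕ} (c : Fin m → ℤ) (hc : StrictMono c) (σ : Equiv.Perm (Fin m))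
    (hσ : σ ≠ 1) :
    ∑ i, (c i - ((i : ℕ) : ℤ)) ^ 2 < ∑ i, (c i - ((σ i : ℕ) : ℤ)) ^ 2 := by
  have hmv : Monovary c (fun i : Fin m => ((i : ℕ) : ℤ)) := by
    intro i j hij
    apply hc.monotone
    have : (i : ℕ) < j := Int.ofNat_lt.1 hij
    exact this.le
  have h1 : ∑ i, c i * ((σ i : ℕ) : ℤ) < ∑ i, c i * ((i : ℕ) : ℤ) := by
    have := (hmv.sum_mul_comp_perm_lt_sum_mul_iff (σ := σ)).2
      (fun h => hσ (aux_perm_eq_one c hc σ h))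
    exact this
  have h2 : ∑ i, ((σ i : ℕ) : ℤ) ^ 2 = ∑ i : Fin m, ((i : ℕ) : ℤ) ^ 2 :=
    Equiv.sum_comp σ (fun i : Fin m => ((i : ℕ) : ℤ) ^ 2)
  have e : ∀ τ : Fin m → Fin m, ∑ i, (c i - ((τ i : ℕ) : ℤ)) ^ 2
      = ∑ i, c i ^ 2 - 2 * ∑ i, c i * ((τ i : ℕ) : ℤ) + ∑ i, ((τ i : ℕ) : ℤ) ^ 2 := by
    intro τ
    rw [Finset.mul_sum, ← Finset.sum_sub_distrib, ← Finset.sum_add_distrib]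
    exact Finset.sum_congr rfl fun i _ => by ring
  have e1 := e σ
  have e2 := e id
  simp only [id] at e2
  rw [e1, e2, h2]
  linarith

theorem aux_mem {S : Type*} [CommRing S] (r : ℕ) (f : ℕ → S) (m : ℕ)
    (H : Matrix (Fin m) (Fin (m + r)) S)
    (hH : ∀ i j, H i j =
      if (i : ℕ) ≤ (j : ℕ) ∧ (j : ℕ) ≤ (i : ℕ) + r then f ((j : ℕ) - (i : ℕ) + 1) else 0)
    (n : ℕ) : ∀ (g : Fin m → ℕ), (∀ i, g i ≤ r) → m * r ^ 2 < n + ∑ i, g i ^ 2 →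
      ∏ i, f (g i + 1) ∈ Ideal.span
      { d : S | ∃ c : Fin m → Fin (m + r), StrictMono c ∧ d = (H.submatrix id c).det } := by
  induction n with
  | zero =>
    intro g hg h
    exfalso
    have : ∑ i, g i ^ 2 ≤ ∑ _i : Fin m, r ^ 2 :=
      Finset.sum_le_sum fun i _ => Nat.pow_le_pow_left (hg i) 2
    simp at this
    omega
  | succ n ih =>
    intro g' hg' hn'
    set J := Ideal.span
      { d : S | ∃ c : Fin m → Fin (m + r), StrictMono c ∧ d = (H.submatrix id c).det } with hJ
    obtain ⟨g, hgdef⟩ : ∃ g : Fin m → ℕ, g = g' ∘ Tuple.sort g' := ⟨_, rfl⟩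
    have hmono : Monotone g := hgdef ▸ Tuple.monotone_sort g'
    have hg : ∀ i, g i ≤ r := fun i => by rw [hgdef]; exact hg' _
    have hn : m * r ^ 2 < n + 1 + ∑ i, g i ^ 2 := by
      have : ∑ i, g i ^ 2 = ∑ i, g' i ^ 2 := by
        rw [hgdef]; exact Equiv.sum_comp (Tuple.sort g') (fun i => g' i ^ 2)
      omega
    have hp : ∏ i, f (g' i + 1) = ∏ i, f (g i + 1) := by
      rw [hgdef]; exact (Equiv.prod_comp (Tuple.sort g') (fun i => f (g' i + 1))).symm
    rw [hp]
    let c : Fin m → Fin (m + r) := fun j => ⟨g j + j, by have := hg j; omega⟩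
    have hc : StrictMono c := by
      intro i j hij
      have h1 := hmono hij.le
      have h2 : (i : ℕ) < j := hij
      change g i + (i : ℕ) < g j + (j : ℕ)
      omega
    have hdet : (H.submatrix id c).det ∈ J := Ideal.subset_span ⟨c, hc, rfl⟩
    rw [Matrix.det_apply, ← Finset.add_sum_erase _ _ (Finset.mem_univ 1)] at hdet
    have hdiag : ∏ i, f (g i + 1) = Equiv.Perm.sign (1 : Equiv.Perm (Fin m)) •
        ∏ i, (H.submatrix id c) ((1 : Equiv.Perm (Fin m)) i) i := by
      simp only [Equiv.Perm.sign_one, one_smul, Equiv.Perm.one_apply]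
      refine Finset.prod_congr rfl fun i _ => ?_
      have := hg i
      simp only [Matrix.submatrix_apply, id, hH, c]
      rw [if_pos ⟨by omega, by omega⟩]
      simp
    rw [hdiag]
    refine (Ideal.add_mem_iff_left J ?_).1 hdet
    refine Ideal.sum_mem _ fun σ hσ => ?_
    have hσ1 : σ ≠ 1 := Finset.ne_of_mem_erase hσ
    rw [Units.smul_def, zsmul_eq_mul]
    apply Ideal.mul_mem_left
    by_cases hall : ∀ i, (σ i : ℕ) ≤ (c i : ℕ) ∧ (c i : ℕ) ≤ (σ i : ℕ) + r
    · have e : ∏ i, (H.submatrix id c) (σ i) i = ∏ i, f (((c i : ℕ) - (σ i : ℕ)) + 1) := by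
        refine Finset.prod_congr rfl fun i _ => ?_
        simp only [Matrix.submatrix_apply, id, hH]
        rw [if_pos (hall i)]
      rw [e]
      apply ih (fun i => (c i : ℕ) - (σ i : ℕ))
      · intro i
        have := hall i
        omega
      · have key := aux_sq_lt (fun i => ((c i : ℕ) : ℤ)) (fun i j hij => by
          have : (c i : ℕ) < c j := hc hij
          exact Int.ofNat_lt.2 this) σ hσ1
        have k1 : ∑ i, (((c i : ℕ) : ℤ) - ((i : ℕ) : ℤ)) ^ 2 = ((∑ i, g i ^ 2 : ℕ) : ℤ) := by
          push_cast
          refine Finset.sum_congr rfl fun i _ => ?_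
          simp [c]
        have k2 : ∑ i, (((c i : ℕ) : ℤ) - ((σ i : ℕ) : ℤ)) ^ 2
            = ((∑ i, ((c i : ℕ) - (σ i : ℕ)) ^ 2 : ℕ) : ℤ) := by
          rw [Nat.cast_sum]
          refine Finset.sum_congr rfl fun i _ => ?_
          rw [Nat.cast_pow, Nat.cast_sub (hall i).1]
        have k3 : ∑ i, g i ^ 2 < ∑ i, ((c i : ℕ) - (σ i : ℕ)) ^ 2 := by
          rw [k1, k2] at key
          exact_mod_cast key
        omega
    · push Not at hall
      obtain ⟨i, hi⟩ := hall
      have : ∏ i, (H.submatrix id c) (σ i) i = 0 := by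
        apply Finset.prod_eq_zero (Finset.mem_univ i)
        simp only [Matrix.submatrix_apply, id, hH]
        rw [if_neg]
        rintro ⟨h1, h2⟩
        have := hi h1
        omega
      rw [this]
      exact Ideal.zero_mem _

/-- Remark (a): if `f 1, …, f (r+1)` is a regular sequence in a commutative ring `S`
generating the ideal `I`, and for `m ≥ 1` the matrix `H` is the `m × (m+r)` matrix
whose `(i,j)` entry (with rows and columns indexed from `0`) is `f (j-i+1)` when
`i ≤ j ≤ i + r` and `0` otherwise (so the `i`-th diagonal of `H` has all entries
equal to `f i`), then `I^m` equals the ideal generated by the `m × m` minors of `H`. -/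
theorem power_of_regular_sequence_is_maximal_minors (S : Type*) [CommRing S]
    (r : ℕ) (f : ℕ → S)
    (hreg : RingTheory.Sequence.IsRegular S (List.ofFn fun i : Fin (r + 1) => f (i + 1)))
    (I : Ideal S) (hI : I = Ideal.span (f '' Set.Icc 1 (r + 1)))
    (m : ℕ) (hm : 1 ≤ m) (H : Matrix (Fin m) (Fin (m + r)) S)
    (hH : ∀ i j, H i j =
      if (i : ℕ) ≤ (j : ℕ) ∧ (j : ℕ) ≤ (i : ℕ) + r then f ((j : ℕ) - (i : ℕ) + 1) else 0) :
    I ^ m = Ideal.span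
      { d : S | ∃ c : Fin m → Fin (m + r), StrictMono c ∧ d = (H.submatrix id c).det } := by
  have hIm : I ^ m = ∏ _i : Fin m, I := by simp
  apply le_antisymm
  · rw [hIm, hI, Ideal.prod_span, Ideal.span_le]
    intro x hx
    obtain ⟨y, hy, rfl⟩ := Set.mem_fintype_prod _ _ |>.1 hx
    choose k hk hk2 using hy
    have e : ∏ i, y i = ∏ i, f ((k (i := i) - 1) + 1) := by
      refine Finset.prod_congr rfl fun i _ => ?_
      rw [Nat.sub_add_cancel (hk (i := i)).1, hk2]
    rw [e]
    refine aux_mem r f m H hH (m * r ^ 2 + 1) (fun i => k (i := i) - 1) (fun i => ?_) (by omega)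
    have := (hk (i := i)).2
    omega
  · rw [Ideal.span_le]
    rintro _ ⟨c, -, rfl⟩
    rw [SetLike.mem_coe, Matrix.det_apply]
    refine Ideal.sum_mem _ fun σ _ => ?_
    rw [Units.smul_def, zsmul_eq_mul]
    apply Ideal.mul_mem_left
    rw [hIm]
    refine Ideal.prod_mem_prod fun i _ => ?_
    simp only [Matrix.submatrix_apply, id, hH]
    split_ifs with h
    · rw [hI]
      exact Ideal.subset_span ⟨_, ⟨by omega, by omega⟩, rfl⟩
    · exact Ideal.zero_mem _
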